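/- There is an absolute constant C > 0 such that the following holds. Let T = {τ_1,…,τ_n} be a set of n polygonal curves in ℝ^d, each of complexity at most m, let k ∈ ℕ, let 2 ≤ ℓ < m with n·m ≥ 2, and let ε ∈ (0,1). Assume there exists a set C* of k polygonal curves in ℝ^d, each of complexity at most ℓ, attaining the optimal (k,ℓ)-median cost r* of T. Then there exists a linear map f : ℝ^d → ℝ^{d′} with d′ ≤ ⌈C·ε^{−2}·ℓ·log(nm)⌉ such that ((1−ε)/(6(1+ε)))·r* ≤ r_f* ≤ (1+ε)·r*, where r_f* is the optimal (k,ℓ)-median cost of F(T) = {F(τ) : τ ∈ T}. -/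

import Mathlib

open scoped Classical RealInnerProductSpace

noncomputable section

/-- A polygonal curve in `ℝ^d`: vertices `v_1, …, v_m`, instants `0 = t_1 < … < t_m = 1`,
and a parameterization `toFun : [0,1] → ℝ^d` that interpolates affinely (traces the line
segment) between consecutive vertices.  `m` is the complexity of the curve. -/
structure PolyCurve (d : ℕ) where
  m : ℕ
  m_pos : 0 < m
  vertex : Fin m → EuclideanSpace ℝ (Fin d)
  instant : Fin m → ℝ
  toFun : ℝ → EuclideanSpace ℝ (Fin d)
  instant_strictMono : StrictMono instant
  instant_first : instant ⟨0, m_pos⟩ = 0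
  instant_last : instant ⟨m - 1, Nat.sub_lt m_pos one_pos⟩ = 1
  affine_on_segments : ∀ i j : Fin m, (j : ℕ) = (i : ℕ) + 1 → ∀ s ∈ Set.Icc (0:ℝ) 1,
    toFun ((1 - s) * instant i + s * instant j) = (1 - s) • vertex i + s • vertex j

/-- The image curve `F(τ)` under a linear map `f`: same instants, vertices `f(v_i)`,
parameterization `f ∘ τ`. -/
def PolyCurve.map {d d' : ℕ} (f : EuclideanSpace ℝ (Fin d) →ₗ[ℝ] EuclideanSpace ℝ (Fin d'))
    (τ : PolyCurve d) : PolyCurve d' where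
  m := τ.m
  m_pos := τ.m_pos
  vertex := fun i => f (τ.vertex i)
  instant := τ.instant
  toFun := fun t => f (τ.toFun t)
  instant_strictMono := τ.instant_strictMono
  instant_first := τ.instant_first
  instant_last := τ.instant_last
  affine_on_segments := by
    intro i j hj s hs
    simp only [τ.affine_on_segments i j hj s hs, map_add, map_smul]

/-- A weak reparameterization: a continuous map of `[0,1]` to itself fixing the endpoints. -/
def IsWeakReparam (φ : ℝ → ℝ) : Prop :=
  ContinuousOn φ (Set.Icc 0 1) ∧ Set.MapsTo φ (Set.Icc 0 1) (Set.Icc 0 1) ∧ φ 0 = 0 ∧ φ 1 = 1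

/-- A reparameterization: a continuous bijection of `[0,1]` onto itself fixing the endpoints. -/
def IsReparam (φ : ℝ → ℝ) : Prop :=
  IsWeakReparam φ ∧ Set.BijOn φ (Set.Icc 0 1) (Set.Icc 0 1)

/-- The (continuous) Fréchet distance between two polygonal curves. -/
def frechetDist {d : ℕ} (σ τ : PolyCurve d) : ℝ :=
  sInf { r | ∃ φ ψ : ℝ → ℝ, IsReparam φ ∧ IsReparam ψ ∧
    r = ⨆ t : Set.Icc (0:ℝ) 1, ‖σ.toFun (φ t.1) - τ.toFun (ψ t.1)‖ }

/-- The weak Fréchet distance between two polygonal curves. -/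
def weakFrechetDist {d : ℕ} (σ τ : PolyCurve d) : ℝ :=
  sInf { r | ∃ φ ψ : ℝ → ℝ, IsWeakReparam φ ∧ IsWeakReparam ψ ∧
    r = ⨆ t : Set.Icc (0:ℝ) 1, ‖σ.toFun (φ t.1) - τ.toFun (ψ t.1)‖ }

/-- `f` is a `(1 ± ε)`-embedding for the point set `P`. -/
def IsJLEmbedding {d d' : ℕ} (ε : ℝ) (f : EuclideanSpace ℝ (Fin d) → EuclideanSpace ℝ (Fin d'))
    (P : Set (EuclideanSpace ℝ (Fin d))) : Prop :=
  ∀ p ∈ P, ∀ q ∈ P,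
    (1 - ε) * ‖p - q‖ ≤ ‖f p - f q‖ ∧ ‖f p - f q‖ ≤ (1 + ε) * ‖p - q‖

/-- `ρ` is a vertex-restricted `ℓ`-simplification of `τ`: it has at most `ℓ` vertices, and its
vertex sequence is a subsequence of the vertex sequence of `τ` starting with the first vertex
of `τ` and ending with its last vertex. -/
def IsVRSimplification {d : ℕ} (ℓ : ℕ) (τ ρ : PolyCurve d) : Prop :=
  ρ.m ≤ ℓ ∧ ∃ g : Fin ρ.m → Fin τ.m, StrictMono g ∧
    (∀ i, ρ.vertex i = τ.vertex (g i)) ∧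
    g ⟨0, ρ.m_pos⟩ = ⟨0, τ.m_pos⟩ ∧
    g ⟨ρ.m - 1, Nat.sub_lt ρ.m_pos one_pos⟩ = ⟨τ.m - 1, Nat.sub_lt τ.m_pos one_pos⟩

/-- The optimal `(k,ℓ)`-median cost of a finite set `T` of polygonal curves: the infimum, over
all sets `C` of `k` polygonal curves each of complexity at most `ℓ`, of
`∑_{τ ∈ T} min_{c ∈ C} d_F(τ, c)`. -/
def kMedianCost {d : ℕ} (k ℓ : ℕ) (T : Finset (PolyCurve d)) : ℝ :=
  sInf { r | ∃ C : Finset (PolyCurve d), C.card = k ∧ (∀ c ∈ C, c.m ≤ ℓ) ∧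
    r = ∑ τ ∈ T, sInf ((fun c => frechetDist τ c) '' ↑C) }

section JL
open MeasureTheory ProbabilityTheory Real

lemma gauss_sq (s : ℝ) (hs : s < 1 / 2) :
    ∫ x, exp (s * x ^ 2) ∂(gaussianReal 0 1) = (√(1 - 2 * s))⁻¹ := by
  rw [integral_gaussianReal_eq_integral_smul one_ne_zero]
  have h : ∀ x : ℝ, gaussianPDFReal 0 1 x • exp (s * x ^ 2)
      = (√(2 * π))⁻¹ * exp (-(1 / 2 - s) * x ^ 2) := by
    intro x
    simp only [gaussianPDFReal, smul_eq_mul, NNReal.coe_one, mul_one, sub_zero]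
    rw [mul_assoc, ← exp_add]
    congr 2
    ring
  simp_rw [h]
  rw [integral_const_mul, integral_gaussian, ← Real.sqrt_inv, ← Real.sqrt_inv,
    ← Real.sqrt_mul (by positivity)]
  congr 1
  have : (1 / 2 - s) ≠ 0 := by linarith
  have h2 : (1 - 2 * s) ≠ 0 := by linarith
  field_simp

lemma std_sq {d : ℕ} (u : EuclideanSpace ℝ (Fin d)) (hu : ‖u‖ = 1) (s : ℝ) (hs : s < 1 / 2) :
    ∫ g, exp (s * ⟪u, g⟫ ^ 2) ∂(stdGaussian (EuclideanSpace ℝ (Fin d)))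
      = (√(1 - 2 * s))⁻¹ := by
  have hm : (stdGaussian (EuclideanSpace ℝ (Fin d))).map (innerSL ℝ u) = gaussianReal 0 1 := by
    rw [IsGaussian.map_eq_gaussianReal, integral_strongDual_stdGaussian,
      variance_dual_stdGaussian]
    simp [hu]
  rw [← gauss_sq s hs, ← hm, integral_map]
  · rfl
  · exact (innerSL ℝ u).continuous.aemeasurable
  · exact Continuous.aestronglyMeasurable (by fun_prop)

lemma pi_sq {d : ℕ} (k : ℕ) (u : EuclideanSpace ℝ (Fin d)) (hu : ‖u‖ = 1)
    (s : ℝ) (hs : s < 1 / 2) :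
    ∫ G : Fin k → EuclideanSpace ℝ (Fin d), exp (s * ∑ i, ⟪u, G i⟫ ^ 2)
      ∂(Measure.pi fun _ => stdGaussian (EuclideanSpace ℝ (Fin d)))
      = (√(1 - 2 * s))⁻¹ ^ k := by
  simp_rw [Finset.mul_sum, exp_sum]
  rw [integral_fintype_prod_eq_prod (fun _ : Fin k => fun g : EuclideanSpace ℝ (Fin d) => exp (s * ⟪u, g⟫ ^ 2))]
  simp_rw [std_sq u hu s hs]
  simp

lemma pi_sq_int {d : ℕ} (k : ℕ) (u : EuclideanSpace ℝ (Fin d)) (hu : ‖u‖ = 1)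
    (s : ℝ) (hs : s < 1 / 2) :
    Integrable (fun G : Fin k → EuclideanSpace ℝ (Fin d) => exp (s * ∑ i, ⟪u, G i⟫ ^ 2))
      (Measure.pi fun _ => stdGaussian (EuclideanSpace ℝ (Fin d))) := by
  by_contra h
  have h1 := pi_sq k u hu s hs
  rw [integral_undef h] at h1
  have : 0 < √(1 - 2 * s) := Real.sqrt_pos.2 (by linarith)
  have : 0 < (√(1 - 2 * s))⁻¹ ^ k := by positivity
  linarith

lemma sqrt_bound1 (x : ℝ) (h0 : 0 < x) (h1 : x ≤ 1 / 2) :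
    (√(1 - x))⁻¹ ≤ exp ((x + x ^ 2) / 2) := by
  have hp : 0 < √(1 - x) := Real.sqrt_pos.2 (by linarith)
  rw [inv_le_comm₀ hp (exp_pos _), ← exp_neg]
  apply Real.le_sqrt_of_sq_le
  rw [← exp_nat_mul, show ((2 : ℕ) : ℝ) * -((x + x ^ 2) / 2) = -(x + x ^ 2) by push_cast; ring, exp_neg]
  rw [inv_le_comm₀ (exp_pos _) (by linarith)]
  refine le_trans ?_ (Real.quadratic_le_exp_of_nonneg (by positivity))
  rw [inv_le_iff_one_le_mul₀ (by linarith)]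
  have : 0 ≤ x ^ 2 * (1 - x - x ^ 2 - x ^ 3) := by
    apply mul_nonneg (by positivity)
    have : x ^ 2 ≤ (1 / 2) ^ 2 := by gcongr
    have : x ^ 3 ≤ (1 / 2) ^ 3 := by gcongr
    linarith
  nlinarith

lemma sqrt_bound2 (x : ℝ) (h0 : 0 < x) :
    (√(1 + x))⁻¹ ≤ exp (-(x - x ^ 2) / 2) := by
  have hp : 0 < √(1 + x) := Real.sqrt_pos.2 (by linarith)
  rw [inv_le_comm₀ hp (exp_pos _), ← exp_neg]
  apply Real.le_sqrt_of_sq_le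
  rw [← exp_nat_mul, show ((2 : ℕ) : ℝ) * -(-(x - x ^ 2) / 2) = -(-(x - x ^ 2)) by push_cast; ring, exp_neg]
  rw [inv_le_comm₀ (exp_pos _) (by linarith)]
  refine le_trans ?_ (Real.add_one_le_exp _)
  rw [inv_le_iff_one_le_mul₀ (by linarith)]
  have : 0 < x ^ 3 := by positivity
  nlinarith

lemma JL_unit {d : ℕ} (k : ℕ) (V : Finset (EuclideanSpace ℝ (Fin d))) (hV : ∀ u ∈ V, ‖u‖ = 1)
    (δ : ℝ) (h0 : 0 < δ) (h1 : δ ≤ 1) (hk : 2 * (V.card : ℝ) * exp (-(k * δ ^ 2 / 8)) < 1) :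
    ∃ G : Fin k → EuclideanSpace ℝ (Fin d), ∀ u ∈ V, |∑ i, ⟪u, G i⟫ ^ 2 - k| ≤ δ * k := by
  set μ := (Measure.pi fun _ : Fin k => stdGaussian (EuclideanSpace ℝ (Fin d))) with hμ
  let A : EuclideanSpace ℝ (Fin d) → (Fin k → EuclideanSpace ℝ (Fin d)) → ℝ := fun u G =>
    exp (-(δ / 4 * (1 + δ) * k)) * exp (δ / 4 * ∑ i, ⟪u, G i⟫ ^ 2)
  let B : EuclideanSpace ℝ (Fin d) → (Fin k → EuclideanSpace ℝ (Fin d)) → ℝ := fun u G =>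
    exp (δ / 4 * (1 - δ) * k) * exp (-(δ / 4) * ∑ i, ⟪u, G i⟫ ^ 2)
  have hA : ∀ u ∈ V, Integrable (A u) μ := fun u hu =>
    (pi_sq_int k u (hV u hu) _ (by linarith)).const_mul _
  have hB : ∀ u ∈ V, Integrable (B u) μ := fun u hu =>
    (pi_sq_int k u (hV u hu) _ (by linarith)).const_mul _
  have iA : ∀ u ∈ V, ∫ G, A u G ∂μ ≤ exp (-(k * δ ^ 2 / 8)) := by
    intro u hu
    simp only [A]
    rw [integral_const_mul, pi_sq k u (hV u hu) _ (by linarith)]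
    have := sqrt_bound1 (δ / 2) (by linarith) (by linarith)
    calc _ ≤ exp (-(δ / 4 * (1 + δ) * k)) * exp ((δ / 2 + (δ / 2) ^ 2) / 2) ^ k := by
          gcongr
          refine le_trans (le_of_eq ?_) this
          congr 2
          ring
      _ = _ := by
          rw [← exp_nat_mul, ← exp_add]
          congr 1; ring
  have iB : ∀ u ∈ V, ∫ G, B u G ∂μ ≤ exp (-(k * δ ^ 2 / 8)) := by
    intro u hu
    simp only [B]
    rw [integral_const_mul, pi_sq k u (hV u hu) _ (by linarith)]
    have := sqrt_bound2 (δ / 2) (by linarith)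
    calc _ ≤ exp (δ / 4 * (1 - δ) * k) * exp (-(δ / 2 - (δ / 2) ^ 2) / 2) ^ k := by
          gcongr
          refine le_trans (le_of_eq ?_) this
          congr 2
          ring
      _ = _ := by
          rw [← exp_nat_mul, ← exp_add]
          congr 1; ring
  have hint : Integrable (fun G => ∑ u ∈ V, (A u G + B u G)) μ :=
    integrable_finsetSum _ fun u hu => (hA u hu).add (hB u hu)
  obtain ⟨G, hG⟩ := exists_le_integral hint
  have hlt : ∑ u ∈ V, (A u G + B u G) < 1 := by
    refine lt_of_le_of_lt hG (lt_of_le_of_lt ?_ hk)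
    rw [integral_finsetSum (f := fun u G => A u G + B u G) _ fun u hu => (hA u hu).add (hB u hu)]
    calc _ ≤ ∑ u ∈ V, (2 * exp (-(k * δ ^ 2 / 8))) := by
          apply Finset.sum_le_sum
          intro u hu
          rw [integral_add (hA u hu) (hB u hu)]
          linarith [iA u hu, iB u hu]
      _ = _ := by rw [Finset.sum_const, nsmul_eq_mul]; ring
  refine ⟨G, fun u hu => ?_⟩
  have hu1 : A u G + B u G < 1 := by
    refine lt_of_le_of_lt ?_ hlt
    exact Finset.single_le_sum (f := fun u => A u G + B u G) (fun u _ => by positivity) hu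
  have hApos : 0 < A u G := by positivity
  have hBpos : 0 < B u G := by positivity
  have a1 : A u G < 1 := by linarith
  have b1 : B u G < 1 := by linarith
  simp only [A, B, ← exp_add, exp_lt_one_iff] at a1 b1
  rw [abs_le]
  constructor <;> nlinarith

lemma JL {d : ℕ} (k : ℕ) (V : Finset (EuclideanSpace ℝ (Fin d))) 
    (δ : ℝ) (h0 : 0 < δ) (h1 : δ ≤ 1) (hk0 : 0 < k)
    (hk : 2 * (V.card : ℝ) * exp (-(k * δ ^ 2 / 8)) < 1) :
    ∃ f : EuclideanSpace ℝ (Fin d) →ₗ[ℝ] EuclideanSpace ℝ (Fin k),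
      ∀ v ∈ V, |‖f v‖ ^ 2 - ‖v‖ ^ 2| ≤ δ * ‖v‖ ^ 2 := by
  let V' := (V.filter (· ≠ 0)).image fun v => ‖v‖⁻¹ • v
  have hc : (V'.card : ℝ) ≤ V.card := by
    exact_mod_cast Finset.card_image_le.trans (Finset.card_filter_le _ _)
  obtain ⟨G, hG⟩ := JL_unit k V' (by
    intro u hu
    simp only [V', Finset.mem_image, Finset.mem_filter] at hu
    obtain ⟨v, ⟨_, hv⟩, rfl⟩ := hu
    exact norm_smul_inv_norm (𝕜 := ℝ) hv) δ h0 h1 (lt_of_le_of_lt (by gcongr) hk)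
  have hkr : (0 : ℝ) < k := by exact_mod_cast hk0
  refine ⟨(WithLp.linearEquiv 2 ℝ (Fin k → ℝ)).symm.toLinearMap ∘ₗ
    LinearMap.pi (fun i => (√(k : ℝ))⁻¹ • (innerSL ℝ (G i)).toLinearMap), fun v hv => ?_⟩
  by_cases hv0 : v = 0
  · simp [hv0]
  have := hG (‖v‖⁻¹ • v) (Finset.mem_image.2 ⟨v, Finset.mem_filter.2 ⟨hv, hv0⟩, rfl⟩)
  have hn : 0 < ‖v‖ := norm_pos_iff.2 hv0
  have e1 : ∑ i, ⟪‖v‖⁻¹ • v, G i⟫ ^ 2 = (‖v‖ ^ 2)⁻¹ * ∑ i, ⟪G i, v⟫ ^ 2 := by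
    rw [Finset.mul_sum]
    refine Finset.sum_congr rfl fun i _ => ?_
    rw [real_inner_smul_left, real_inner_comm]; ring
  rw [e1] at this
  have e2 : ‖((WithLp.linearEquiv 2 ℝ (Fin k → ℝ)).symm.toLinearMap ∘ₗ
    LinearMap.pi (fun i => (√(k : ℝ))⁻¹ • (innerSL ℝ (G i)).toLinearMap)) v‖ ^ 2
      = (k : ℝ)⁻¹ * ∑ i, ⟪G i, v⟫ ^ 2 := by
    rw [EuclideanSpace.norm_sq_eq, Finset.mul_sum]
    refine Finset.sum_congr rfl fun i _ => ?_
    simp [mul_pow, inv_pow, Real.sq_sqrt hkr.le]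
  rw [e2]
  set S := ∑ i, ⟪G i, v⟫ ^ 2
  have e3 : (k : ℝ)⁻¹ * S - ‖v‖ ^ 2 = (‖v‖ ^ 2 / k) * ((‖v‖ ^ 2)⁻¹ * S - k) := by
    field_simp
  rw [e3, abs_mul, abs_of_pos (by positivity)]
  calc _ ≤ ‖v‖ ^ 2 / k * (δ * k) := by gcongr
    _ = _ := by field_simp

lemma JL_sub {d : ℕ} (k : ℕ) (P : Finset (EuclideanSpace ℝ (Fin d)))
    (ε : ℝ) (h0 : 0 < ε) (h1 : ε < 1) (hk0 : 0 < k)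
    (hk : 72 * (P.card : ℝ) ^ 6 * exp (-(k * (ε / 12) ^ 2 / 8)) < 1) :
    ∃ f : EuclideanSpace ℝ (Fin d) →ₗ[ℝ] EuclideanSpace ℝ (Fin k),
      ∀ p : Fin 6 → EuclideanSpace ℝ (Fin d), (∀ i, p i ∈ P) →
        ∀ x ∈ Submodule.span ℝ (Set.range p),
          (1 - ε) * ‖x‖ ≤ ‖f x‖ ∧ ‖f x‖ ≤ (1 + ε) * ‖x‖ := by
  let W : (Fin 6 → EuclideanSpace ℝ (Fin d)) → Submodule ℝ (EuclideanSpace ℝ (Fin d)) :=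
    fun p => Submodule.span ℝ (Set.range p)
  have hW : ∀ p, Module.finrank ℝ (W p) ≤ 6 := fun p => by
    
    have h := finrank_range_le_card (R := ℝ) p
    rw [Fintype.card_fin] at h
    exact h
  let b := fun p => stdOrthonormalBasis ℝ (W p)
  let V : Finset (EuclideanSpace ℝ (Fin d)) := (Fintype.piFinset fun _ : Fin 6 => P).biUnion
    fun p => Finset.univ.image fun ij : Fin (Module.finrank ℝ (W p)) × Fin (Module.finrank ℝ (W p)) =>
      ((b p ij.1 : EuclideanSpace ℝ (Fin d)) + (b p ij.2 : EuclideanSpace ℝ (Fin d)))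
  have hVc : V.card ≤ P.card ^ 6 * 36 := by
    have := Finset.card_biUnion_le_card_mul (Fintype.piFinset fun _ : Fin 6 => P)
      (fun p => Finset.univ.image fun ij : Fin (Module.finrank ℝ (W p)) × Fin (Module.finrank ℝ (W p)) =>
      ((b p ij.1 : EuclideanSpace ℝ (Fin d)) + (b p ij.2 : EuclideanSpace ℝ (Fin d)))) 36 (by
        intro p _
        refine Finset.card_image_le.trans ?_
        simp only [Finset.card_univ, Fintype.card_prod, Fintype.card_fin]
        exact Nat.mul_le_mul (hW p) (hW p))
    simpa using this
  have hVc' : (V.card : ℝ) ≤ P.card ^ 6 * 36 := by exact_mod_cast hVc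
  obtain ⟨f, hf⟩ := JL k V (ε / 12) (by linarith) (by linarith) hk0
    (lt_of_le_of_lt (by
      have := exp_pos (-(k * (ε / 12) ^ 2 / 8))
      nlinarith) hk)
  refine ⟨f, fun p hp x hx => ?_⟩
  have hb : ∀ i j, |‖f (b p i) + f (b p j)‖ ^ 2 - ‖(b p i : EuclideanSpace ℝ (Fin d)) + b p j‖ ^ 2|
      ≤ ε / 12 * ‖(b p i : EuclideanSpace ℝ (Fin d)) + b p j‖ ^ 2 := by
    intro i j
    rw [← map_add]
    exact hf _ (Finset.mem_biUnion.2 ⟨p, by simpa using hp,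
      Finset.mem_image.2 ⟨(i, j), Finset.mem_univ _, rfl⟩⟩)
  have hort : ∀ i j, ⟪(b p i : EuclideanSpace ℝ (Fin d)), (b p j : EuclideanSpace ℝ (Fin d))⟫
      = if i = j then (1 : ℝ) else 0 := by
    intro i j
    rw [← Submodule.coe_inner]
    exact orthonormal_iff_ite.1 (b p).orthonormal i j
  have hexp : ∀ i j, ‖(b p i : EuclideanSpace ℝ (Fin d)) + b p j‖ ^ 2
      = 2 + 2 * if i = j then (1 : ℝ) else 0 := by
    intro i j
    rw [norm_add_sq_real, hort, ← real_inner_self_eq_norm_sq, ← real_inner_self_eq_norm_sq, hort, hort]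
    simp only [if_true]; ring
  have hd : ∀ i, |‖f (b p i)‖ ^ 2 - 1| ≤ ε / 12 := by
    intro i
    have := hb i i
    rw [hexp, ← two_smul ℝ, norm_smul] at this
    simp only [if_true, Real.norm_ofNat, mul_pow] at this
    rw [abs_le] at this ⊢
    constructor <;> linarith
  have hE : ∀ i j, |⟪f (b p i), f (b p j)⟫ - ⟪(b p i : EuclideanSpace ℝ (Fin d)), (b p j : EuclideanSpace ℝ (Fin d))⟫| ≤ ε / 6 := by
    intro i j
    have h3 := hb i j
    have h4 := hd i
    have h5 := hd j
    rw [hexp, norm_add_sq_real] at h3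
    rw [hort]
    rw [abs_le] at *
    by_cases hij : i = j
    · subst hij
      rw [real_inner_self_eq_norm_sq]
      simp only [if_true] at *
      constructor <;> linarith
    · simp only [hij, if_false] at *
      constructor <;> linarith
  set c : Fin (Module.finrank ℝ (W p)) → ℝ := fun i => (b p).repr ⟨x, hx⟩ i with hc
  have hxs : x = ∑ i, c i • (b p i : EuclideanSpace ℝ (Fin d)) := by
    have := congrArg (Subtype.val) ((b p).sum_repr ⟨x, hx⟩)
    refine this.symm.trans ?_
    simp [hc]
  have hfx : f x = ∑ i, c i • f (b p i) := by
    conv_lhs => rw [hxs]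
    simp
  have n1 : ‖x‖ ^ 2 = ∑ i, ∑ j, c i * c j * ⟪(b p i : EuclideanSpace ℝ (Fin d)), (b p j : EuclideanSpace ℝ (Fin d))⟫ := by
    rw [← real_inner_self_eq_norm_sq]
    conv_lhs => rw [hxs]
    simp only [sum_inner, inner_sum, real_inner_smul_left, real_inner_smul_right]
    rw [Finset.sum_comm]
    exact Finset.sum_congr rfl fun i _ => Finset.sum_congr rfl fun j _ => by ring_nf
  have n2 : ‖f x‖ ^ 2 = ∑ i, ∑ j, c i * c j * ⟪f (b p i), f (b p j)⟫ := by
    rw [← real_inner_self_eq_norm_sq, hfx]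
    simp only [sum_inner, inner_sum, real_inner_smul_left, real_inner_smul_right]
    rw [Finset.sum_comm]
    exact Finset.sum_congr rfl fun i _ => Finset.sum_congr rfl fun j _ => by ring_nf
  have n3 : ‖x‖ ^ 2 = ∑ i, |c i| ^ 2 := by
    rw [n1]
    simp [hort, sq]
  have hkey : |‖f x‖ ^ 2 - ‖x‖ ^ 2| ≤ ε * ‖x‖ ^ 2 := by
    rw [n2, n1, ← Finset.sum_sub_distrib]
    simp_rw [← Finset.sum_sub_distrib, ← mul_sub]
    rw [← n1]
    calc _ ≤ ∑ i, ∑ j, |c i| * |c j| * (ε / 6) := by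
          refine (Finset.abs_sum_le_sum_abs _ _).trans (Finset.sum_le_sum fun i _ => ?_)
          refine (Finset.abs_sum_le_sum_abs _ _).trans (Finset.sum_le_sum fun j _ => ?_)
          rw [abs_mul, abs_mul]
          gcongr
          exact hE i j
      _ = (ε / 6) * (∑ i, |c i|) ^ 2 := by
          rw [sq, Finset.sum_mul_sum, Finset.mul_sum]
          refine Finset.sum_congr rfl fun i _ => ?_
          rw [Finset.mul_sum]
          exact Finset.sum_congr rfl fun j _ => by ring
      _ ≤ (ε / 6) * (6 * ‖x‖ ^ 2) := by
          gcongr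
          rw [n3]
          refine sq_sum_le_card_mul_sum_sq.trans ?_
          gcongr
          simpa using hW p
      _ = _ := by ring
  rw [abs_le] at hkey
  constructor
  · refine abs_le_of_sq_le_sq' ?_ (norm_nonneg _) |>.2
    rw [mul_pow]
    nlinarith [sq_nonneg ‖x‖]
  · refine abs_le_of_sq_le_sq' ?_ (by positivity) |>.2
    rw [mul_pow]
    nlinarith [sq_nonneg ‖x‖]
end JL

section Curves
variable {d d' : ℕ}

lemma PolyCurve.two_le (τ : PolyCurve d) : 2 ≤ τ.m := by
  by_contra h
  have h1 : τ.m = 1 := by have := τ.m_pos; omega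
  have h2 : (⟨0, τ.m_pos⟩ : Fin τ.m) = ⟨τ.m - 1, Nat.sub_lt τ.m_pos one_pos⟩ := by
    apply Fin.ext; simp [h1]
  have h3 := τ.instant_first
  rw [h2, τ.instant_last] at h3
  exact one_ne_zero h3

lemma inst_cover {m : ℕ} (m_pos : 0 < m) (inst : Fin m → ℝ) (hm : StrictMono inst)
    (h0 : inst ⟨0, m_pos⟩ = 0) (h1 : inst ⟨m - 1, Nat.sub_lt m_pos one_pos⟩ = 1)
    (t : ℝ) (ht : t ∈ Set.Icc (0 : ℝ) 1) :
    ∃ i j : Fin m, (j : ℕ) = i + 1 ∧ ∃ s ∈ Set.Icc (0 : ℝ) 1, t = (1 - s) * inst i + s * inst j := by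
  have hm2 : 2 ≤ m := by
    by_contra h
    have h1' : m = 1 := by omega
    have h2 : (⟨0, m_pos⟩ : Fin m) = ⟨m - 1, Nat.sub_lt m_pos one_pos⟩ := by
      apply Fin.ext; simp [h1']
    rw [h2, h1] at h0
    exact one_ne_zero h0
  let S := Finset.univ.filter fun i => inst i ≤ t
  have hS : S.Nonempty := ⟨⟨0, m_pos⟩, by simp [S, h0, ht.1]⟩
  have hi : inst (S.max' hS) ≤ t := (Finset.mem_filter.1 (S.max'_mem hS)).2
  set i := S.max' hS with hidef
  by_cases hlt : (i : ℕ) + 1 < m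
  · have hj : t < inst ⟨i + 1, hlt⟩ := by
      by_contra hcon
      have hmem : (⟨i + 1, hlt⟩ : Fin m) ∈ S := Finset.mem_filter.2 ⟨Finset.mem_univ _, not_lt.1 hcon⟩
      have := S.le_max' _ hmem
      rw [← hidef, Fin.le_def] at this
      simp at this
    have hpos : 0 < inst ⟨i + 1, hlt⟩ - inst i := by linarith
    refine ⟨i, ⟨i + 1, hlt⟩, rfl, (t - inst i) / (inst ⟨i + 1, hlt⟩ - inst i), ⟨?_, ?_⟩, ?_⟩
    · exact div_nonneg (by linarith) hpos.le
    · rw [div_le_one hpos]; linarith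
    · field_simp; ring
  · have hieq : i = ⟨m - 1, Nat.sub_lt m_pos one_pos⟩ := by
      apply Fin.ext
      have := i.2
      simp only; omega
    rw [hieq, h1] at hi
    have ht1 : t = 1 := le_antisymm ht.2 hi
    refine ⟨⟨m - 2, by omega⟩, ⟨m - 1, by omega⟩, by simp only; omega, 1, ⟨zero_le_one, le_rfl⟩, ?_⟩
    rw [h1]; linarith

lemma inst_unique {m : ℕ} (inst : Fin m → ℝ) (hm : StrictMono inst)
    (v : Fin m → EuclideanSpace ℝ (Fin d)) (i j i' j' : Fin m) (hj : (j : ℕ) = i + 1)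
    (hj' : (j' : ℕ) = i' + 1) (s s' : ℝ) (hs : s ∈ Set.Icc (0 : ℝ) 1) (hs' : s' ∈ Set.Icc (0 : ℝ) 1)
    (h : (1 - s) * inst i + s * inst j = (1 - s') * inst i' + s' * inst j') :
    (1 - s) • v i + s • v j = (1 - s') • v i' + s' • v j' := by
  wlog hle : (i : ℕ) ≤ i' generalizing i j i' j' s s'
  · exact (this i' j' i j hj' hj s' s hs' hs h.symm (by omega)).symm
  have hij : inst i < inst j := hm (Fin.lt_def.2 (by omega))
  have hij' : inst i' < inst j' := hm (Fin.lt_def.2 (by omega))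
  obtain ⟨hs0, hs1⟩ := hs
  obtain ⟨hs0', hs1'⟩ := hs'
  rcases hle.eq_or_lt with he | hl
  · have e1 : i = i' := Fin.ext he
    subst e1
    have e2 : j = j' := Fin.ext (by omega)
    subst e2
    have : (s - s') * (inst j - inst i) = 0 := by linarith
    rcases mul_eq_zero.1 this with h2 | h2
    · have : s = s' := by linarith
      rw [this]
    · linarith
  · have hji : inst j ≤ inst i' := hm.monotone (Fin.le_def.2 (by omega))
    have a1 : 0 ≤ (1 - s) * (inst j - inst i) := mul_nonneg (by linarith) (by linarith)
    have a2 : 0 ≤ s' * (inst j' - inst i') := mul_nonneg (by linarith) (by linarith)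
    have b1 : (1 - s) * (inst j - inst i) = 0 := by nlinarith
    have b2 : s' * (inst j' - inst i') = 0 := by nlinarith
    have c1 : s = 1 := by
      rcases mul_eq_zero.1 b1 with h2 | h2 <;> linarith
    have c2 : s' = 0 := by
      rcases mul_eq_zero.1 b2 with h2 | h2 <;> linarith
    subst c1 c2
    have : inst j = inst i' := by linarith
    have := hm.injective this
    subst this
    simp

/-- The polygonal curve with prescribed instants and vertices. -/
def PolyCurve.ofData (m : ℕ) (m_pos : 0 < m) (v : Fin m → EuclideanSpace ℝ (Fin d))
    (inst : Fin m → ℝ) (hm : StrictMono inst) (h0 : inst ⟨0, m_pos⟩ = 0)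
    (h1 : inst ⟨m - 1, Nat.sub_lt m_pos one_pos⟩ = 1) : PolyCurve d where
  m := m
  m_pos := m_pos
  vertex := v
  instant := inst
  toFun := fun t => if h : ∃ x, ∃ i j : Fin m, (j : ℕ) = i + 1 ∧ ∃ s ∈ Set.Icc (0 : ℝ) 1,
    t = (1 - s) * inst i + s * inst j ∧ x = (1 - s) • v i + s • v j then h.choose else 0
  instant_strictMono := hm
  instant_first := h0
  instant_last := h1
  affine_on_segments := by
    intro i j hj s hs
    have h : ∃ x, ∃ i' j' : Fin m, (j' : ℕ) = i' + 1 ∧ ∃ s' ∈ Set.Icc (0 : ℝ) 1,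
      (1 - s) * inst i + s * inst j = (1 - s') * inst i' + s' * inst j' ∧
        x = (1 - s') • v i' + s' • v j' := ⟨_, i, j, hj, s, hs, rfl, rfl⟩
    rw [dif_pos h]
    obtain ⟨i', j', hj', s', hs', e1, e2⟩ := h.choose_spec
    rw [e2]
    exact (inst_unique inst hm v i j i' j' hj hj' s s' hs hs' e1).symm

lemma PolyCurve.cover (τ : PolyCurve d) (t : ℝ) (ht : t ∈ Set.Icc (0 : ℝ) 1) :
    ∃ i j : Fin τ.m, (j : ℕ) = i + 1 ∧ ∃ s ∈ Set.Icc (0 : ℝ) 1,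
      t = (1 - s) * τ.instant i + s * τ.instant j ∧
      τ.toFun t = (1 - s) • τ.vertex i + s • τ.vertex j := by
  obtain ⟨i, j, hj, s, hs, e⟩ := inst_cover τ.m_pos τ.instant τ.instant_strictMono
    τ.instant_first τ.instant_last t ht
  exact ⟨i, j, hj, s, hs, e, by rw [e]; exact τ.affine_on_segments i j hj s hs⟩

lemma PolyCurve.instant_mem (τ : PolyCurve d) (i : Fin τ.m) : τ.instant i ∈ Set.Icc (0 : ℝ) 1 := by
  constructor
  · rw [← τ.instant_first]
    exact τ.instant_strictMono.monotone (Fin.le_def.2 (Nat.zero_le _))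
  · rw [← τ.instant_last]
    exact τ.instant_strictMono.monotone (Fin.le_def.2 (by have := i.2; simp only; omega))

lemma PolyCurve.toFun_instant (τ : PolyCurve d) (i : Fin τ.m) :
    τ.toFun (τ.instant i) = τ.vertex i := by
  by_cases h : (i : ℕ) + 1 < τ.m
  · have := τ.affine_on_segments i ⟨i + 1, h⟩ rfl 0 ⟨le_rfl, zero_le_one⟩
    simpa using this
  · have h2 := τ.two_le
    have := τ.affine_on_segments ⟨i - 1, by omega⟩ i (by simp only; omega) 1 ⟨zero_le_one, le_rfl⟩
    simpa using this

lemma PolyCurve.bounded (τ : PolyCurve d) :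
    ∃ M, ∀ t ∈ Set.Icc (0 : ℝ) 1, ‖τ.toFun t‖ ≤ M := by
  refine ⟨∑ i, ‖τ.vertex i‖, fun t ht => ?_⟩
  obtain ⟨i, j, hj, s, hs, _, e⟩ := τ.cover t ht
  have h1 := Finset.single_le_sum (f := fun i => ‖τ.vertex i‖) (fun i _ => norm_nonneg _) (Finset.mem_univ i)
  have h2 := Finset.single_le_sum (f := fun i => ‖τ.vertex i‖) (fun i _ => norm_nonneg _) (Finset.mem_univ j)
  rw [e]
  obtain ⟨hs0, hs1⟩ := hs
  refine (norm_add_le _ _).trans ?_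
  rw [norm_smul, norm_smul, Real.norm_of_nonneg hs0, Real.norm_of_nonneg (by linarith : 0 ≤ 1 - s)]
  nlinarith

lemma IsReparam.mem {φ : ℝ → ℝ} (h : IsReparam φ) {t : ℝ} (ht : t ∈ Set.Icc (0 : ℝ) 1) :
    φ t ∈ Set.Icc (0 : ℝ) 1 := h.1.2.1 ht

lemma isReparam_id : IsReparam id :=
  ⟨⟨continuousOn_id, Set.mapsTo_id _, rfl, rfl⟩, Set.bijOn_id _⟩

lemma frechetDist_nonneg (σ τ : PolyCurve d) : 0 ≤ frechetDist σ τ := by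
  apply Real.sInf_nonneg
  rintro r ⟨φ, ψ, _, _, rfl⟩
  exact Real.iSup_nonneg fun _ => norm_nonneg _

lemma frechetDist_le (σ τ : PolyCurve d) (φ ψ : ℝ → ℝ) (hφ : IsReparam φ) (hψ : IsReparam ψ)
    (R : ℝ) (h : ∀ t ∈ Set.Icc (0 : ℝ) 1, ‖σ.toFun (φ t) - τ.toFun (ψ t)‖ ≤ R) :
    frechetDist σ τ ≤ R := by
  have : Nonempty (Set.Icc (0 : ℝ) 1) := ⟨⟨0, le_rfl, zero_le_one⟩⟩
  have h2 : (⨆ t : Set.Icc (0:ℝ) 1, ‖σ.toFun (φ t.1) - τ.toFun (ψ t.1)‖) ≤ R :=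
    ciSup_le fun t => h t.1 t.2
  refine le_trans ?_ h2
  unfold frechetDist
  refine csInf_le ⟨0, ?_⟩ ⟨φ, ψ, hφ, hψ, rfl⟩
  rintro r ⟨φ, ψ, _, _, rfl⟩
  exact Real.iSup_nonneg fun _ => norm_nonneg _

lemma frechetDist_exists (σ τ : PolyCurve d) (η : ℝ) (hη : 0 < η) :
    ∃ φ ψ, IsReparam φ ∧ IsReparam ψ ∧
      ∀ t ∈ Set.Icc (0 : ℝ) 1, ‖σ.toFun (φ t) - τ.toFun (ψ t)‖ ≤ frechetDist σ τ + η := by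
  have hne : { r | ∃ φ ψ : ℝ → ℝ, IsReparam φ ∧ IsReparam ψ ∧
    r = ⨆ t : Set.Icc (0:ℝ) 1, ‖σ.toFun (φ t.1) - τ.toFun (ψ t.1)‖ }.Nonempty :=
    ⟨_, id, id, isReparam_id, isReparam_id, rfl⟩
  obtain ⟨r, ⟨φ, ψ, hφ, hψ, rfl⟩, hr⟩ := exists_lt_of_csInf_lt hne (lt_add_of_pos_right _ hη)
  refine ⟨φ, ψ, hφ, hψ, fun t ht => ?_⟩
  refine le_trans ?_ hr.le
  obtain ⟨M, hM⟩ := σ.bounded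
  obtain ⟨N, hN⟩ := τ.bounded
  refine le_ciSup (f := fun t : Set.Icc (0:ℝ) 1 => ‖σ.toFun (φ t.1) - τ.toFun (ψ t.1)‖)
    ⟨M + N, ?_⟩ ⟨t, ht⟩
  rintro _ ⟨u, rfl⟩
  exact (norm_sub_le _ _).trans (add_le_add (hM _ (hφ.mem u.2)) (hN _ (hψ.mem u.2)))

lemma frechetDist_map_le (f : EuclideanSpace ℝ (Fin d) →ₗ[ℝ] EuclideanSpace ℝ (Fin d'))
    (σ τ : PolyCurve d) (K : ℝ) (hK : 0 ≤ K)
    (h : ∀ s ∈ Set.Icc (0 : ℝ) 1, ∀ t ∈ Set.Icc (0 : ℝ) 1,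
      ‖f (σ.toFun s - τ.toFun t)‖ ≤ K * ‖σ.toFun s - τ.toFun t‖) :
    frechetDist (σ.map f) (τ.map f) ≤ K * frechetDist σ τ := by
  apply le_of_forall_pos_le_add
  intro η hη
  obtain ⟨φ, ψ, hφ, hψ, hb⟩ := frechetDist_exists σ τ (η / (K + 1)) (by positivity)
  apply frechetDist_le _ _ φ ψ hφ hψ
  intro t ht
  have h1 := h _ (hφ.mem ht) _ (hψ.mem ht)
  rw [map_sub] at h1
  refine h1.trans ((mul_le_mul_of_nonneg_left (hb t ht) hK).trans ?_)
  rw [mul_add]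
  gcongr
  rw [mul_div_assoc', div_le_iff₀ (by positivity)]
  nlinarith

lemma lift_curve (f : EuclideanSpace ℝ (Fin d) →ₗ[ℝ] EuclideanSpace ℝ (Fin d'))
    (τ : PolyCurve d) (c : PolyCurve d') (η : ℝ) (hη : 0 < η) :
    ∃ ρ : PolyCurve d, ρ.m = c.m ∧ ∀ s ∈ Set.Icc (0 : ℝ) 1,
      ‖c.toFun s - f (ρ.toFun s)‖ ≤ frechetDist (τ.map f) c + η ∧
      ∃ a ∈ Set.Icc (0 : ℝ) 1, ∃ b ∈ Set.Icc (0 : ℝ) 1, ∃ u : ℝ,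
        ρ.toFun s = (1 - u) • τ.toFun a + u • τ.toFun b := by
  obtain ⟨φ, ψ, hφ, hψ, hb⟩ := frechetDist_exists (τ.map f) c η hη
  have hp : ∀ j : Fin c.m, ∃ p ∈ Set.Icc (0 : ℝ) 1,
      ‖c.vertex j - f (τ.toFun p)‖ ≤ frechetDist (τ.map f) c + η := by
    intro j
    obtain ⟨t, ht, e⟩ := hψ.2.surjOn (c.instant_mem j)
    refine ⟨φ t, hφ.mem ht, ?_⟩
    have := hb t ht
    rw [e, c.toFun_instant, norm_sub_rev] at this
    exact this
  choose p hp1 hp2 using hp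
  let ρ := PolyCurve.ofData c.m c.m_pos (fun j => τ.toFun (p j)) c.instant c.instant_strictMono
    c.instant_first c.instant_last
  refine ⟨ρ, rfl, fun s hs => ?_⟩
  obtain ⟨i, j, hj, u, hu, e1, e2⟩ := c.cover s hs
  have e3 : ρ.toFun s = (1 - u) • τ.toFun (p i) + u • τ.toFun (p j) := by
    rw [e1]; exact ρ.affine_on_segments i j hj u hu
  refine ⟨?_, p i, hp1 i, p j, hp1 j, u, e3⟩
  rw [e2, e3, map_add, map_smul, map_smul]
  have : (1 - u) • c.vertex i + u • c.vertex j - ((1 - u) • f (τ.toFun (p i)) + u • f (τ.toFun (p j)))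
    = (1 - u) • (c.vertex i - f (τ.toFun (p i))) + u • (c.vertex j - f (τ.toFun (p j))) := by
    simp only [smul_sub]; abel
  rw [this]
  obtain ⟨hs0, hs1⟩ := hu
  refine (norm_add_le _ _).trans ?_
  rw [norm_smul, norm_smul, Real.norm_of_nonneg hs0, Real.norm_of_nonneg (by linarith : 0 ≤ 1 - u)]
  nlinarith [hp2 i, hp2 j]

lemma frechetDist_lift (f : EuclideanSpace ℝ (Fin d) →ₗ[ℝ] EuclideanSpace ℝ (Fin d'))
    (σ ρ : PolyCurve d) (c : PolyCurve d') (K r : ℝ) (hK : 0 < K)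
    (h : ∀ s ∈ Set.Icc (0 : ℝ) 1, ∀ t ∈ Set.Icc (0 : ℝ) 1,
      K * ‖σ.toFun s - ρ.toFun t‖ ≤ ‖f (σ.toFun s - ρ.toFun t)‖)
    (hr : ∀ s ∈ Set.Icc (0 : ℝ) 1, ‖c.toFun s - f (ρ.toFun s)‖ ≤ r) :
    K * frechetDist σ ρ ≤ frechetDist (σ.map f) c + r := by
  apply le_of_forall_pos_le_add
  intro η hη
  obtain ⟨φ, ψ, hφ, hψ, hb⟩ := frechetDist_exists (σ.map f) c η hη
  rw [← le_div_iff₀' hK]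
  apply frechetDist_le _ _ φ ψ hφ hψ
  intro t ht
  rw [le_div_iff₀' hK]
  refine (h _ (hφ.mem ht) _ (hψ.mem ht)).trans ?_
  have h1 := hb t ht
  have h2 := hr _ (hψ.mem ht)
  have h3 : f (σ.toFun (φ t) - ρ.toFun (ψ t)) = ((σ.map f).toFun (φ t) - c.toFun (ψ t))
      + (c.toFun (ψ t) - f (ρ.toFun (ψ t))) := by
    rw [map_sub]; simp [PolyCurve.map]
  rw [h3]
  refine (norm_add_le _ _).trans ?_
  linarith

lemma PolyCurve.map_inj (f : EuclideanSpace ℝ (Fin d) →ₗ[ℝ] EuclideanSpace ℝ (Fin d'))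
    (σ τ : PolyCurve d) (h : σ.map f = τ.map f) (h2 : σ.toFun = τ.toFun) : σ = τ := by
  have hv := σ.toFun_instant
  have hv' := τ.toFun_instant
  obtain ⟨m, mp, v, inst, F, _, _, _, _⟩ := σ
  obtain ⟨m', mp', v', inst', F', _, _, _, _⟩ := τ
  simp only [PolyCurve.map, PolyCurve.mk.injEq] at h
  obtain ⟨rfl, h3, h4, h5⟩ := h
  simp only at h2 hv hv'
  subst h2
  have h4 := eq_of_heq h4
  subst h4
  have : v = v' := by
    funext i
    rw [← hv, ← hv']
  subst this
  rfl

lemma infinite_curves (hd : 0 < d) (ℓ : ℕ) (hl : 2 ≤ ℓ) : {c : PolyCurve d | c.m ≤ ℓ}.Infinite := by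
  have : Nonempty (Fin d) := ⟨⟨0, hd⟩⟩
  let g : EuclideanSpace ℝ (Fin d) → PolyCurve d := fun v =>
    PolyCurve.ofData 2 two_pos (fun _ => v) (fun i => (i : ℝ)) (by
      intro i j hij; simpa using hij) (by simp) (by simp)
  have hg : Function.Injective g := by
    intro v w h
    have h1 := (g v).toFun_instant ⟨0, two_pos⟩
    have h2 := (g w).toFun_instant ⟨0, two_pos⟩
    have h3 : (g v).toFun 0 = v := by simpa [g, PolyCurve.ofData] using h1
    have h4 : (g w).toFun 0 = w := by simpa [g, PolyCurve.ofData] using h2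
    rw [← h3, ← h4, h]
  have : Infinite (EuclideanSpace ℝ (Fin d)) := 
    Module.Free.infinite ℝ (EuclideanSpace ℝ (Fin d))
  refine (Set.infinite_range_of_injective hg).mono ?_
  rintro _ ⟨v, rfl⟩
  exact hl

lemma pad (hd : 0 < d) (k ℓ : ℕ) (hl : 2 ≤ ℓ) (hk : 0 < k) (C : Finset (PolyCurve d))
    (hC : ∀ c ∈ C, c.m ≤ ℓ) (hc : C.card ≤ k) :
    ∃ C' : Finset (PolyCurve d), C ⊆ C' ∧ C'.card = k ∧ ∀ c ∈ C', c.m ≤ ℓ := by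
  obtain ⟨S, h1, h2, h3⟩ := (infinite_curves hd ℓ hl).exists_superset_ncard_eq (s := (C : Set (PolyCurve d)))
    (fun c hc => hC c hc) C.finite_toSet (k := k) (by simpa using hc)
  have hfin : S.Finite := Set.finite_of_ncard_ne_zero (by omega)
  refine ⟨hfin.toFinset, ?_, ?_, ?_⟩
  · intro c hc; simpa using h1 hc
  · rw [← h3, Set.ncard_eq_toFinset_card _ hfin]
  · intro c hc; exact h2 (by simpa using hc)

lemma inner_le (τ : PolyCurve d) (C : Finset (PolyCurve d)) (c : PolyCurve d) (hc : c ∈ C) :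
    sInf ((fun c => frechetDist τ c) '' (C : Set (PolyCurve d))) ≤ frechetDist τ c :=
  csInf_le ⟨0, by rintro _ ⟨x, _, rfl⟩; exact frechetDist_nonneg _ _⟩ ⟨c, hc, rfl⟩

lemma inner_attained (τ : PolyCurve d) (C : Finset (PolyCurve d)) (hC : C.Nonempty) :
    ∃ c ∈ C, frechetDist τ c = sInf ((fun c => frechetDist τ c) '' (C : Set (PolyCurve d))) := by
  have := Set.Nonempty.csInf_mem (s := (fun c => frechetDist τ c) '' (C : Set (PolyCurve d)))
    (hC.to_set.image _) (C.finite_toSet.image _)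
  obtain ⟨c, hc, e⟩ := this
  exact ⟨c, hc, e⟩

lemma inner_nonneg' (τ : PolyCurve d) (C : Finset (PolyCurve d)) :
    0 ≤ sInf ((fun c => frechetDist τ c) '' (C : Set (PolyCurve d))) := by
  apply Real.sInf_nonneg
  rintro _ ⟨x, _, rfl⟩; exact frechetDist_nonneg _ _

lemma kMedianCost_le (k ℓ : ℕ) (T C : Finset (PolyCurve d)) (hk : C.card = k)
    (hl : ∀ c ∈ C, c.m ≤ ℓ) :
    kMedianCost k ℓ T ≤ ∑ τ ∈ T, sInf ((fun c => frechetDist τ c) '' (C : Set (PolyCurve d))) := by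
  refine csInf_le ⟨0, ?_⟩ ⟨C, hk, hl, rfl⟩
  rintro _ ⟨C, _, _, rfl⟩
  exact Finset.sum_nonneg fun _ _ => inner_nonneg' _ _

lemma kMedianCost_nonneg (k ℓ : ℕ) (T : Finset (PolyCurve d)) : 0 ≤ kMedianCost k ℓ T := by
  apply Real.sInf_nonneg
  rintro _ ⟨C, _, _, rfl⟩
  exact Finset.sum_nonneg fun _ _ => inner_nonneg' _ _

lemma sInf_all_zero (S : Set ℝ) (h : ∀ r ∈ S, r = 0) : sInf S = 0 := by
  rcases S.eq_empty_or_nonempty with rfl | ⟨r, hr⟩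
  · exact Real.sInf_empty
  · have : S = {0} := by
      ext x; constructor
      · exact h x
      · rintro rfl; rw [← h r hr]; exact hr
    rw [this, csInf_singleton]

lemma kMedianCost_k_zero (ℓ : ℕ) (T : Finset (PolyCurve d)) : kMedianCost 0 ℓ T = 0 := by
  apply sInf_all_zero
  rintro _ ⟨C, hC, _, rfl⟩
  rw [Finset.card_eq_zero] at hC
  subst hC
  simp

lemma kMedianCost_d_zero (k ℓ : ℕ) (T : Finset (PolyCurve 0)) : kMedianCost k ℓ T = 0 := by
  apply sInf_all_zero
  rintro _ ⟨C, hC, _, rfl⟩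
  apply Finset.sum_eq_zero
  intro τ _
  apply sInf_all_zero
  rintro _ ⟨c, _, rfl⟩
  refine le_antisymm ?_ (frechetDist_nonneg _ _)
  apply frechetDist_le _ _ id id isReparam_id isReparam_id
  intro t _
  rw [Subsingleton.elim (τ.toFun (id t) - c.toFun (id t)) 0, norm_zero]

lemma PolyCurve.mem_span (τ : PolyCurve d) (t : ℝ) (ht : t ∈ Set.Icc (0 : ℝ) 1) :
    ∃ i j : Fin τ.m, ∀ W : Submodule ℝ (EuclideanSpace ℝ (Fin d)), τ.vertex i ∈ W →
      τ.vertex j ∈ W → τ.toFun t ∈ W := by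
  obtain ⟨i, j, _, s, _, _, e⟩ := τ.cover t ht
  refine ⟨i, j, fun W h1 h2 => ?_⟩
  rw [e]
  exact W.add_mem (W.smul_mem _ h1) (W.smul_mem _ h2)

/-- A vector separating two curves, if there is one. -/
def sepVec (σ τ : PolyCurve d) : EuclideanSpace ℝ (Fin d) :=
  if h : ∃ t, σ.toFun t - τ.toFun t ≠ 0 then σ.toFun h.choose - τ.toFun h.choose else 0

end Curves

section Main

lemma upper_bound {d d' : ℕ} (hd' : 0 < d') (k ℓ : ℕ) (hl : 2 ≤ ℓ) (hk : 0 < k)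
    (T Cs : Finset (PolyCurve d)) (hCs : Cs.card = k) (hCl : ∀ c ∈ Cs, c.m ≤ ℓ)
    (g : PolyCurve d → PolyCurve d) (hg : ∀ τ ∈ T, g τ ∈ Cs)
    (f : EuclideanSpace ℝ (Fin d) →ₗ[ℝ] EuclideanSpace ℝ (Fin d')) (K : ℝ)
    (hf : ∀ τ ∈ T, frechetDist (τ.map f) ((g τ).map f) ≤ K * frechetDist τ (g τ))
    (hinj : Set.InjOn (PolyCurve.map f) (T : Set (PolyCurve d))) :
    kMedianCost k ℓ (T.image (PolyCurve.map f)) ≤ K * ∑ τ ∈ T, frechetDist τ (g τ) := by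
  obtain ⟨C', h1, h2, h3⟩ := pad hd' k ℓ hl hk (Cs.image (PolyCurve.map f)) (by
    intro c hc
    obtain ⟨c0, hc0, rfl⟩ := Finset.mem_image.1 hc
    exact hCl c0 hc0) (Finset.card_image_le.trans hCs.le)
  refine (kMedianCost_le k ℓ _ C' h2 h3).trans ?_
  rw [Finset.sum_image hinj, Finset.mul_sum]
  refine Finset.sum_le_sum fun τ hτ => ?_
  exact (inner_le _ _ _ (h1 (Finset.mem_image_of_mem _ (hg τ hτ)))).trans (hf τ hτ)

lemma lower_bound {d d' : ℕ} (hd : 0 < d) (hd' : 0 < d') (k ℓ : ℕ) (hl : 2 ≤ ℓ) (hk : 0 < k)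
    (T : Finset (PolyCurve d)) (hT : T.Nonempty)
    (f : EuclideanSpace ℝ (Fin d) →ₗ[ℝ] EuclideanSpace ℝ (Fin d')) (K : ℝ) (hK : 0 < K)
    (hf : ∀ σ ∈ T, ∀ τ ∈ T, ∀ s ∈ Set.Icc (0 : ℝ) 1, ∀ a ∈ Set.Icc (0 : ℝ) 1,
      ∀ b ∈ Set.Icc (0 : ℝ) 1, ∀ u : ℝ,
      K * ‖σ.toFun s - ((1 - u) • τ.toFun a + u • τ.toFun b)‖
        ≤ ‖f (σ.toFun s - ((1 - u) • τ.toFun a + u • τ.toFun b))‖)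
    (hinj : Set.InjOn (PolyCurve.map f) (T : Set (PolyCurve d))) :
    K * kMedianCost k ℓ T ≤ 2 * kMedianCost k ℓ (T.image (PolyCurve.map f)) := by
  rw [← div_le_iff₀' two_pos]
  refine le_csInf ?_ ?_
  · obtain ⟨C, _, h1, h2⟩ := pad hd' k ℓ hl hk ∅ (by simp) (by simp)
    exact ⟨_, C, h1, h2, rfl⟩
  rintro _ ⟨C, hCk, hCl, rfl⟩
  rw [div_le_iff₀' two_pos]
  have hCne : C.Nonempty := Finset.card_pos.1 (by omega)
  rw [Finset.sum_image hinj]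
  apply le_of_forall_pos_le_add
  intro η hη
  have hn : (0 : ℝ) < T.card := by exact_mod_cast hT.card_pos
  have hmin : ∀ c : PolyCurve d', ∃ τ ∈ T, ∀ σ ∈ T,
      frechetDist (τ.map f) c ≤ frechetDist (σ.map f) c := fun c =>
    T.exists_min_image (fun τ => frechetDist (τ.map f) c) hT
  choose a ha hamin using hmin
  choose ρ hρm hρ using fun c => lift_curve f (a c) c (η / T.card) (by positivity)
  obtain ⟨C', h1, h2, h3⟩ := pad hd k ℓ hl hk (C.image ρ) (by
    intro c hc
    obtain ⟨c0, hc0, rfl⟩ := Finset.mem_image.1 hc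
    rw [hρm]
    exact hCl c0 hc0) (Finset.card_image_le.trans hCk.le)
  refine (mul_le_mul_of_nonneg_left (kMedianCost_le k ℓ T C' h2 h3) hK.le).trans ?_
  rw [Finset.mul_sum, Finset.mul_sum]
  have hη' : η = ∑ τ ∈ T, η / T.card := by
    rw [Finset.sum_const, nsmul_eq_mul]; field_simp
  conv_rhs => rw [hη']
  rw [← Finset.sum_add_distrib]
  refine Finset.sum_le_sum fun σ hσ => ?_
  obtain ⟨c, hc, e⟩ := inner_attained (σ.map f) C hCne
  rw [← e]
  have hle := inner_le σ C' (ρ c) (h1 (Finset.mem_image_of_mem _ hc))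
  refine (mul_le_mul_of_nonneg_left hle hK.le).trans ?_
  have := frechetDist_lift f σ (ρ c) c K _ hK (by
    intro s hs t ht
    obtain ⟨x, hx, y, hy, u, hu⟩ := (hρ c t ht).2
    rw [hu]
    exact hf σ hσ (a c) (ha c) s hs x hx y hy u) (fun s hs => (hρ c s hs).1)
  have h5 := hamin c σ hσ
  linarith

/-- The vertex set of a curve. -/
def PolyCurve.verts {d : ℕ} (τ : PolyCurve d) : Finset (EuclideanSpace ℝ (Fin d)) :=
  Finset.univ.image τ.vertex

lemma PolyCurve.card_verts {d : ℕ} (τ : PolyCurve d) : τ.verts.card ≤ τ.m := by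
  refine Finset.card_image_le.trans ?_
  simp

lemma PolyCurve.vertex_mem {d : ℕ} (τ : PolyCurve d) (i : Fin τ.m) : τ.vertex i ∈ τ.verts :=
  Finset.mem_image_of_mem _ (Finset.mem_univ i)

lemma dim_estimate (N : ℕ) (hN : 3 ≤ N) (ℓ : ℕ) (hl : 2 ≤ ℓ) (p : ℕ) (hp : p ≤ N ^ 3)
    (ε : ℝ) (h0 : 0 < ε) (k : ℕ) (hk : 30000 * ε⁻¹ ^ 2 * (ℓ : ℝ) * Real.log N ≤ k) :
    0 < k ∧ 72 * (p : ℝ) ^ 6 * Real.exp (-(k * (ε / 12) ^ 2 / 8)) < 1 := by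
  have hNr : (3 : ℝ) ≤ N := by exact_mod_cast hN
  have hlr : (2 : ℝ) ≤ ℓ := by exact_mod_cast hl
  have hlog : 0 < Real.log N := Real.log_pos (by linarith)
  have hk2 : 30000 * ε⁻¹ ^ 2 * 2 * Real.log N ≤ k := le_trans (by gcongr) hk
  have hkpos : (0 : ℝ) < k := lt_of_lt_of_le (by positivity) hk2
  refine ⟨by exact_mod_cast hkpos, ?_⟩
  have hpr : (p : ℝ) ≤ N ^ 3 := by exact_mod_cast hp
  have h1 : 72 * (p : ℝ) ^ 6 ≤ (N : ℝ) ^ 22 := by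
    have h72 : (72 : ℝ) ≤ (N : ℝ) ^ 4 := by
      calc (72 : ℝ) ≤ 3 ^ 4 := by norm_num
        _ ≤ _ := by gcongr
    calc 72 * (p : ℝ) ^ 6 ≤ (N : ℝ) ^ 4 * (N ^ 3) ^ 6 := by gcongr
      _ = _ := by ring
  have h2 : 22 * Real.log N < k * (ε / 12) ^ 2 / 8 := by
    have h3 : 30000 * ε⁻¹ ^ 2 * 2 * Real.log N * (ε / 12) ^ 2 / 8 ≤ k * (ε / 12) ^ 2 / 8 := by
      gcongr
    have h4 : 30000 * ε⁻¹ ^ 2 * 2 * Real.log N * (ε / 12) ^ 2 / 8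
        = 60000 / 1152 * Real.log N := by
      field_simp; norm_num
    rw [h4] at h3
    linarith
  have h5 : (N : ℝ) ^ 22 = Real.exp (22 * Real.log N) := by
    rw [show (22 : ℝ) = ((22 : ℕ) : ℝ) by norm_num, Real.exp_nat_mul, Real.exp_log (by linarith)]
  calc _ ≤ Real.exp (22 * Real.log N) * Real.exp (-(k * (ε / 12) ^ 2 / 8)) := by
        rw [← h5]; gcongr
    _ < 1 := by
        rw [← Real.exp_add, Real.exp_lt_one_iff]; linarith

lemma main_case {d n m k ℓ : ℕ} (hd : 0 < d) (hk : 0 < k) (T : Finset (PolyCurve d))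
    (hTn : T.card = n) (hTm : ∀ τ ∈ T, τ.m ≤ m) (hl : 2 ≤ ℓ) (hlm : ℓ < m) (hnm : 2 ≤ n * m)
    (ε : ℝ) (h0 : 0 < ε) (h1 : ε < 1) (Cs : Finset (PolyCurve d)) (hCk : Cs.card = k)
    (hCl : ∀ c ∈ Cs, c.m ≤ ℓ)
    (hopt : ∑ τ ∈ T, sInf ((fun c => frechetDist τ c) '' ↑Cs) = kMedianCost k ℓ T)
    (d' : ℕ) (hd' : 30000 * ε⁻¹ ^ 2 * (ℓ : ℝ) * Real.log ((n : ℝ) * (m : ℝ)) ≤ d') :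
    ∃ f : EuclideanSpace ℝ (Fin d) →ₗ[ℝ] EuclideanSpace ℝ (Fin d'),
        ((1 - ε) / (6 * (1 + ε))) * kMedianCost k ℓ T ≤
            kMedianCost k ℓ (T.image (PolyCurve.map f)) ∧
        kMedianCost k ℓ (T.image (PolyCurve.map f)) ≤ (1 + ε) * kMedianCost k ℓ T := by
  have hn : 0 < n := by
    rcases Nat.eq_zero_or_pos n with rfl | h
    · omega
    · exact h
  have hT : T.Nonempty := Finset.card_pos.1 (by omega)
  have hCne : Cs.Nonempty := Finset.card_pos.1 (by omega)
  choose g hgC hg using fun τ : PolyCurve d => inner_attained τ Cs hCne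
  let P : Finset (EuclideanSpace ℝ (Fin d)) := T.biUnion (fun τ => τ.verts) ∪
    (T.biUnion (fun τ => (g τ).verts) ∪ (T ×ˢ T).image fun q => sepVec q.1 q.2)
  have hN : 3 ≤ n * m := by nlinarith
  have hP : P.card ≤ (n * m) ^ 3 := by
    have c1 : (T.biUnion (fun τ => τ.verts)).card ≤ n * m := by
      rw [← hTn]
      exact Finset.card_biUnion_le_card_mul _ _ _ fun τ hτ => τ.card_verts.trans (hTm τ hτ)
    have c2 : (T.biUnion (fun τ => (g τ).verts)).card ≤ n * m := by
      rw [← hTn]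
      exact Finset.card_biUnion_le_card_mul _ _ _ fun τ hτ =>
        (g τ).card_verts.trans ((hCl _ (hgC τ)).trans hlm.le)
    have c3 : ((T ×ˢ T).image fun q => sepVec q.1 q.2).card ≤ n * n := by
      refine Finset.card_image_le.trans ?_
      rw [Finset.card_product, hTn]
    have c4 : P.card ≤ n * m + (n * m + n * n) :=
      (Finset.card_union_le _ _).trans
        (add_le_add c1 ((Finset.card_union_le _ _).trans (add_le_add c2 c3)))
    have c5 : n * n ≤ (n * m) ^ 2 := by
      rw [sq]
      exact Nat.mul_le_mul (Nat.le_mul_of_pos_right _ (by omega))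
        (Nat.le_mul_of_pos_right _ (by omega))
    have c6 : n * m ≤ (n * m) ^ 2 := by nlinarith
    calc P.card ≤ 3 * (n * m) ^ 2 := by omega
      _ ≤ (n * m) * (n * m) ^ 2 := Nat.mul_le_mul_right _ hN
      _ = _ := by ring
  obtain ⟨hd'0, hexp⟩ := dim_estimate (n * m) hN ℓ hl P.card hP ε h0 d' (by
    push_cast; exact hd')
  obtain ⟨f, hf⟩ := JL_sub d' P ε h0 h1 hd'0 hexp
  have hPT : ∀ τ ∈ T, ∀ i, τ.vertex i ∈ P := fun τ hτ i =>
    Finset.mem_union_left _ (Finset.mem_biUnion.2 ⟨τ, hτ, τ.vertex_mem i⟩)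
  have hPg : ∀ τ ∈ T, ∀ i, (g τ).vertex i ∈ P := fun τ hτ i =>
    Finset.mem_union_right _ (Finset.mem_union_left _
      (Finset.mem_biUnion.2 ⟨τ, hτ, (g τ).vertex_mem i⟩))
  have hinj : Set.InjOn (PolyCurve.map f) (T : Set (PolyCurve d)) := by
    intro σ hσ τ hτ h
    refine PolyCurve.map_inj f σ τ h ?_
    by_contra hne
    have hex : ∃ t, σ.toFun t - τ.toFun t ≠ 0 := by
      by_contra hcon
      push Not at hcon
      exact hne (funext fun t => sub_eq_zero.1 (hcon t))
    have hmem : sepVec σ τ ∈ P := Finset.mem_union_right _ (Finset.mem_union_right _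
      (Finset.mem_image.2 ⟨(σ, τ), Finset.mem_product.2 ⟨hσ, hτ⟩, rfl⟩))
    have hb := (hf (fun _ => sepVec σ τ) (fun _ => hmem) (sepVec σ τ)
      (Submodule.subset_span ⟨0, rfl⟩)).1
    have hsv : sepVec σ τ = σ.toFun hex.choose - τ.toFun hex.choose := dif_pos hex
    have hfz : f (sepVec σ τ) = 0 := by
      rw [hsv, map_sub, sub_eq_zero]
      exact congrFun (congrArg PolyCurve.toFun h) hex.choose
    have hpos : 0 < ‖sepVec σ τ‖ := by
      rw [norm_pos_iff, hsv]; exact hex.choose_spec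
    rw [hfz, norm_zero] at hb
    nlinarith
  have hopt' : ∑ τ ∈ T, frechetDist τ (g τ) = kMedianCost k ℓ T := by
    rw [← hopt]
    exact Finset.sum_congr rfl fun τ _ => hg τ
  refine ⟨f, ?_, ?_⟩
  · have hlow := lower_bound hd hd'0 k ℓ hl hk T hT f (1 - ε) (by linarith) (by
      intro σ hσ τ hτ s hs a ha b hb u
      obtain ⟨i1, i2, w1⟩ := σ.mem_span s hs
      obtain ⟨i3, i4, w2⟩ := τ.mem_span a ha
      obtain ⟨i5, i6, w3⟩ := τ.mem_span b hb
      refine (hf ![σ.vertex i1, σ.vertex i2, τ.vertex i3, τ.vertex i4, τ.vertex i5, τ.vertex i6]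
        ?_ _ ?_).1
      · intro i
        fin_cases i
        exacts [hPT σ hσ _, hPT σ hσ _, hPT τ hτ _, hPT τ hτ _, hPT τ hτ _, hPT τ hτ _]
      · refine Submodule.sub_mem _ (w1 _ ?_ ?_) (Submodule.add_mem _
          (Submodule.smul_mem _ _ (w2 _ ?_ ?_)) (Submodule.smul_mem _ _ (w3 _ ?_ ?_)))
        exacts [Submodule.subset_span ⟨0, rfl⟩, Submodule.subset_span ⟨1, rfl⟩,
          Submodule.subset_span ⟨2, rfl⟩, Submodule.subset_span ⟨3, rfl⟩,
          Submodule.subset_span ⟨4, rfl⟩, Submodule.subset_span ⟨5, rfl⟩]) hinj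
    have hnn := kMedianCost_nonneg k ℓ (T.image (PolyCurve.map f))
    rw [div_mul_eq_mul_div, div_le_iff₀ (by positivity)]
    nlinarith
  · rw [← hopt']
    refine upper_bound hd'0 k ℓ hl hk T Cs hCk hCl g (fun τ _ => hgC τ) f (1 + ε) ?_ hinj
    intro τ hτ
    refine frechetDist_map_le f τ (g τ) (1 + ε) (by linarith) ?_
    intro s hs t ht
    obtain ⟨i1, i2, w1⟩ := τ.mem_span s hs
    obtain ⟨i3, i4, w2⟩ := (g τ).mem_span t ht
    refine (hf ![τ.vertex i1, τ.vertex i2, (g τ).vertex i3, (g τ).vertex i4, (g τ).vertex i3,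
      (g τ).vertex i4] ?_ _ ?_).2
    · intro i
      fin_cases i
      exacts [hPT τ hτ _, hPT τ hτ _, hPg τ hτ _, hPg τ hτ _, hPg τ hτ _, hPg τ hτ _]
    · refine Submodule.sub_mem _ (w1 _ ?_ ?_) (w2 _ ?_ ?_)
      exacts [Submodule.subset_span ⟨0, rfl⟩, Submodule.subset_span ⟨1, rfl⟩,
        Submodule.subset_span ⟨2, rfl⟩, Submodule.subset_span ⟨3, rfl⟩]

end Main

/-- dimension reduction to O(ε⁻² ℓ log(nm)) dimensions preserving the optimal
(k,ℓ)-median cost within a factor, for restricted medians (2 ≤ ℓ < m). -/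
theorem statement13 : ∃ C : ℝ, 0 < C ∧
    ∀ (d n m k ℓ : ℕ) (T : Finset (PolyCurve d)), T.card = n → (∀ τ ∈ T, τ.m ≤ m) →
      2 ≤ ℓ → ℓ < m → 2 ≤ n * m → ∀ ε : ℝ, ε ∈ Set.Ioo (0:ℝ) 1 →
      (∃ Cstar : Finset (PolyCurve d), Cstar.card = k ∧ (∀ c ∈ Cstar, c.m ≤ ℓ) ∧
        ∑ τ ∈ T, sInf ((fun c => frechetDist τ c) '' ↑Cstar) = kMedianCost k ℓ T) →
      ∃ (d' : ℕ) (f : EuclideanSpace ℝ (Fin d) →ₗ[ℝ] EuclideanSpace ℝ (Fin d')),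
        d' ≤ ⌈C * ε⁻¹ ^ 2 * (ℓ : ℝ) * Real.log ((n : ℝ) * (m : ℝ))⌉₊ ∧
        ((1 - ε) / (6 * (1 + ε))) * kMedianCost k ℓ T ≤
            kMedianCost k ℓ (T.image (PolyCurve.map f)) ∧
        kMedianCost k ℓ (T.image (PolyCurve.map f)) ≤ (1 + ε) * kMedianCost k ℓ T := by
  refine ⟨30000, by norm_num, ?_⟩
  intro d n m k ℓ T hTn hTm hl hlm hnm ε hε ⟨Cs, hCk, hCl, hopt⟩
  by_cases hk : k = 0
  · subst hk
    exact ⟨0, 0, Nat.zero_le _, by simp [kMedianCost_k_zero], by simp [kMedianCost_k_zero]⟩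
  by_cases hd : d = 0
  · subst hd
    exact ⟨0, 0, Nat.zero_le _, by simp [kMedianCost_d_zero], by simp [kMedianCost_d_zero]⟩
  obtain ⟨f, hf⟩ := main_case (Nat.pos_of_ne_zero hd) (Nat.pos_of_ne_zero hk) T hTn hTm hl hlm hnm
    ε hε.1 hε.2 Cs hCk hCl hopt _ (Nat.le_ceil _)
  exact ⟨_, f, le_rfl, hf⟩

end
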